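/- For every strategy ξ ∈ Stra_A(𝕋) there exists a winning agent strategy σ_a ∈ 𝔖_a on the knowledge-based game arena G such that for every compatible environment T ∈ 𝕋 the sequence of X-components of the agent vertices of the outcome play π_{σ_a,σ_e^T} equals the path ρ^T_ξ (hence cost_G(π_{σ_a,σ_e^T}) = cost(ρ^T_ξ)), and reg_𝕋(ξ) = reg_G(σ_a). -/

import Mathlib

namespace RegretLTL

/-- A deterministic finite automaton over alphabet `2^AP`. -/
structure DFAut (Q AP : Type) where
  q0 : Q
  f : Q → Finset AP → Q
  QF : Set Q

/-- A partially-known weighted transition system. -/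
structure PKWTS (X AP : Type) where
  x0 : X
  Δ : X → Finset (Finset X)
  Δ_nonempty : ∀ x, (Δ x).Nonempty
  w : X → X → ℝ
  w_nonneg : ∀ x y, 0 ≤ w x y
  L : X → Finset AP
  x0_known : (Δ x0).card = 1

variable {X Q AP : Type} [DecidableEq X] [Fintype X] [Fintype Q] [Fintype AP]
  [Inhabited X] [Inhabited Q]

/-- The pattern recorded for `x` in a knowledge-set (junk value `∅` if absent). -/
def lookupO (K : List (X × Finset X)) (x : X) : Finset X :=
  ((K.find? (fun k => decide (k.1 = x))).map Prod.snd).getD ∅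

/-- `x` has been explored in the knowledge-set `K`, i.e. `x ∈ X(K)`. -/
def Explored (K : List (X × Finset X)) (x : X) : Prop := ∃ o, (x, o) ∈ K

/-- Knowledge-set update. -/
def kupdate (K : List (X × Finset X)) (κ : X × Finset X) : List (X × Finset X) :=
  if K.any (fun k => decide (k.1 = κ.1)) then K else K ++ [κ]

variable (M : PKWTS X AP) (D : DFAut Q AP) (K0 : List (X × Finset X))

/-- `K0` is the initial knowledge-set: it lists (in some fixed order) each known
state together with its unique successor pattern. -/
def IsInitK : Prop :=
  (K0.map Prod.fst).Nodup ∧ (∀ p ∈ K0, M.Δ p.1 = {p.2}) ∧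
    ∀ x : X, (M.Δ x).card = 1 → ∃ o, (x, o) ∈ K0

/-- A compatible environment `T ∈ 𝕋`, given by its transition function. -/
def CompatEnv := { δ : X → Finset X // ∀ x, δ x ∈ M.Δ x }

/-- A finite path of the environment with transition function `δ`, starting at `x0`. -/
def IsEnvPath (δ : X → Finset X) (ρ : List X) : Prop :=
  ρ ≠ [] ∧ ρ.head? = some M.x0 ∧ ρ.Chain' (fun a b => b ∈ δ a)

/-- Cost of a finite path. -/
def costP (ρ : List X) : ℝ := (List.zipWith M.w ρ ρ.tail).sum

/-- Run of the DFA on the labels of a sequence of states. -/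
def frun (q : Q) (xs : List X) : Q := xs.foldl (fun q x => D.f q (M.L x)) q

/-- The finite path `ρ = x0 x1 ⋯ xn` accomplishes the task:
`f(q0, L(x0)⋯L(x_{n-1})) ∈ QF`. -/
def Accomplishes (ρ : List X) : Prop :=
  ρ ≠ [] ∧ frun M D D.q0 ρ.dropLast ∈ D.QF

/-- A history of the PK-WTS. -/
def IsHistory (h : List (X × Finset X)) : Prop :=
  h ≠ [] ∧ (h.map Prod.fst).head? = some M.x0 ∧
  (∀ p ∈ h, p.2 ∈ M.Δ p.1) ∧
  h.Chain' (fun p p' => p'.1 ∈ p.2) ∧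
  ∀ p ∈ h, ∀ p' ∈ h, p.1 = p'.1 → p.2 = p'.2

/-- Validity of a strategy for the PK-WTS: it moves to a successor in the last
observed pattern, or stops. -/
def XiValid (ξ : List (X × Finset X) → Option X) : Prop :=
  ∀ h p x, IsHistory M h → h.getLast? = some p → ξ h = some x → x ∈ p.2

/-- The history induced from a path in a fixed environment. -/
def histOf (δ : X → Finset X) (ρ : List X) : List (X × Finset X) :=
  ρ.map (fun x => (x, δ x))

/-- `ρ` is the outcome path `ρ^T_ξ` of strategy `ξ` in environment `δ`. -/
def IsOutcomePath (ξ : List (X × Finset X) → Option X) (δ : X → Finset X)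
    (ρ : List X) : Prop :=
  IsEnvPath M δ ρ ∧
  (∀ i (h : i + 1 < ρ.length),
    ξ (histOf δ (ρ.take (i+1))) = some (ρ[i+1]'h)) ∧
  ξ (histOf δ ρ) = none

open Classical in
/-- The outcome path `ρ^T_ξ` (junk `[]` if it does not exist). -/
noncomputable def outcomePath (ξ : List (X × Finset X) → Option X)
    (T : CompatEnv M) : List X :=
  if h : ∃ ρ, IsOutcomePath M ξ T.1 ρ then h.choose else []

/-- `Stra_A(𝕋)`: strategies whose outcome path exists and accomplishes the task in
every compatible environment. -/
def StraA : Set (List (X × Finset X) → Option X) :=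
  { ξ | XiValid M ξ ∧
      ∀ T : CompatEnv M, ∃ ρ, IsOutcomePath M ξ T.1 ρ ∧ Accomplishes M D ρ }

/-- The regret of a strategy `ξ` in the partially-known environment `𝕋`. -/
noncomputable def regT (ξ : List (X × Finset X) → Option X) : ℝ :=
  sSup { r | ∃ T : CompatEnv M,
    costP M (outcomePath M ξ T) -
      sInf { c | ∃ ξ' ∈ StraA M D, costP M (outcomePath M ξ' T) = c } = r }

/-- Vertices of the knowledge-based game arena. -/
inductive Vtx (X Q : Type) where
  | ag (x : X) (q : Q) (K : List (X × Finset X))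
  | env (x : X) (q : Q) (K : List (X × Finset X)) (xh : X)

instance : Inhabited (Vtx X Q) := ⟨.ag default default []⟩

def IsAgV : Vtx X Q → Prop
  | .ag _ _ _ => True
  | _ => False

def IsEnvV : Vtx X Q → Prop
  | .env _ _ _ _ => True
  | _ => False

/-- Knowledge-set component of a vertex. -/
def Kof : Vtx X Q → List (X × Finset X)
  | .ag _ _ K => K
  | .env _ _ K _ => K

/-- The fourth (target-state) component of an environment vertex. -/
def tgtOf : Vtx X Q → Option X
  | .env _ _ _ xh => some xh
  | _ => none

/-- Edges of the knowledge-based game arena. -/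
def Edge : Vtx X Q → Vtx X Q → Prop
  | .ag x q K, .env x' q' K' xh =>
      x' = x ∧ q' = q ∧ K' = K ∧ Explored K x ∧ xh ∈ lookupO K x
  | .env xe qe Ke xh, .ag xa qa Ka =>
      xa = xh ∧ qa = D.f qe (M.L xe) ∧ ∃ o ∈ M.Δ xa, Ka = kupdate Ke (xa, o)
  | _, _ => False

/-- Initial vertex of the arena. -/
def v0 : Vtx X Q := .ag M.x0 D.q0 K0

/-- Weight function of the arena. -/
def wG : Vtx X Q → Vtx X Q → ℝ
  | .env xe _ _ _, .ag xa _ _ => M.w xe xa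
  | _, _ => 0

/-- A play: a finite directed path in the arena starting at `v0`. -/
def IsPlay (π : List (Vtx X Q)) : Prop :=
  π.head? = some (v0 M D K0) ∧ π.Chain' (Edge M D)

/-- Cost of a play. -/
def costG (π : List (Vtx X Q)) : ℝ := (List.zipWith (wG M) π π.tail).sum

/-- Accepting (final) vertices `V_F`. -/
def InVF : Vtx X Q → Prop
  | Vtx.ag _ q _ => q ∈ D.QF
  | _ => False

/-- Validity of an agent strategy: along plays ending at an agent vertex, it
either stops or moves along an edge of the arena. -/
def AValid (σa : List (Vtx X Q) → Option (Vtx X Q)) : Prop :=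
  ∀ π u v, IsPlay M D K0 π → π.getLast? = some u → IsAgV u → σa π = some v →
    Edge M D u v

/-- Validity of a (positional) environment strategy: it moves along edges of the
arena, and it reveals the same successor pattern whenever the same unexplored
state is entered. This defines membership in `𝔖_e`. -/
def EValid (σe : Vtx X Q → Vtx X Q) : Prop :=
  (∀ v, IsEnvV v → Edge M D v (σe v)) ∧
  (∀ (x : X) (q : Q) (K : List (X × Finset X)) (x' : X) (q' : Q)
      (K' : List (X × Finset X)) (xh : X),
    ¬ Explored K xh → ¬ Explored K' xh →
    lookupO (Kof (σe (.env x q K xh))) xh = lookupO (Kof (σe (.env x' q' K' xh))) xh)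

/-- The set `𝔖_e` of environment strategies. -/
def SE : Set (Vtx X Q → Vtx X Q) := { σe | EValid M D σe }

/-- `π` is the outcome play `π_{σa,σe}`. -/
def IsOutcome (σa : List (Vtx X Q) → Option (Vtx X Q)) (σe : Vtx X Q → Vtx X Q)
    (π : List (Vtx X Q)) : Prop :=
  IsPlay M D K0 π ∧
  (∀ i (h : i + 1 < π.length),
    (IsAgV (π[i]'(Nat.lt_of_succ_lt h)) → σa (π.take (i+1)) = some (π[i+1]'h)) ∧
    (IsEnvV (π[i]'(Nat.lt_of_succ_lt h)) → σe (π[i]'(Nat.lt_of_succ_lt h)) = π[i+1]'h)) ∧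
  IsAgV π.getLast! ∧ σa π = none

open Classical in
/-- The outcome play `π_{σa,σe}` (junk `[]` if it does not exist). -/
noncomputable def outcome (σa : List (Vtx X Q) → Option (Vtx X Q))
    (σe : Vtx X Q → Vtx X Q) : List (Vtx X Q) :=
  if h : ∃ π, IsOutcome M D K0 σa σe π then h.choose else []

/-- The set `𝔖_a` of winning agent strategies. -/
def SA : Set (List (Vtx X Q) → Option (Vtx X Q)) :=
  { σa | AValid M D K0 σa ∧
      ∀ σe ∈ SE M D, ∃ π, IsOutcome M D K0 σa σe π ∧ InVF D π.getLast! }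

/-- `min_{σa' ∈ 𝔖_a} cost_G(π_{σa',σe})`. -/
noncomputable def bestCost (σe : Vtx X Q → Vtx X Q) : ℝ :=
  sInf { c | ∃ σa ∈ SA M D K0, costG M (outcome M D K0 σa σe) = c }

/-- The regret `reg_G^{σe}(σa)` of `σa` against `σe`. -/
noncomputable def regAgainst (σa : List (Vtx X Q) → Option (Vtx X Q))
    (σe : Vtx X Q → Vtx X Q) : ℝ :=
  costG M (outcome M D K0 σa σe) - bestCost M D K0 σe

/-- The regret `reg_G(σa)`. -/
noncomputable def regG (σa : List (Vtx X Q) → Option (Vtx X Q)) : ℝ :=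
  sSup { r | ∃ σe ∈ SE M D, regAgainst M D K0 σa σe = r }

/-- Positional agent strategies. -/
def PositionalA (σa : List (Vtx X Q) → Option (Vtx X Q)) : Prop :=
  ∀ π π' : List (Vtx X Q), π.getLast? = π'.getLast? → σa π = σa π'

/-- `T ∈ 𝕋_K`. -/
def InTK (K : List (X × Finset X)) (T : CompatEnv M) : Prop :=
  ∀ p ∈ K, T.1 p.1 = p.2

/-- Best response `br(K)`. -/
noncomputable def br (K : List (X × Finset X)) : ℝ :=
  sInf { c | ∃ T : CompatEnv M, InTK M K T ∧
    ∃ ρ, IsEnvPath M T.1 ρ ∧ Accomplishes M D ρ ∧ costP M ρ = c }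

/-- Minimum cost of a play from `v0` to `v`. -/
noncomputable def SPcost (v : Vtx X Q) : ℝ :=
  sInf { c | ∃ π, IsPlay M D K0 π ∧ π.getLast? = some v ∧ costG M π = c }

/-- The edge `(u,v)` occurs on the play `π`. -/
def EdgeOn (u v : Vtx X Q) (π : List (Vtx X Q)) : Prop := (u, v) ∈ π.zip π.tail

/-- `(u,v) ∈ E_SP`: `(u,v)` lies on a minimum-cost play from `v0` to `V_F`. -/
def inESP (u v : Vtx X Q) : Prop :=
  ∃ π vf, IsPlay M D K0 π ∧ π.getLast? = some vf ∧ InVF D vf ∧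
    costG M π = SPcost M D K0 vf ∧ EdgeOn u v π

open Classical in
/-- The modified weight function `μ`, with values in `EReal`. -/
noncomputable def mu (u v : Vtx X Q) : EReal :=
  if IsEnvV u ∧ IsAgV v then
    (if inESP M D K0 u v then
      (if InVF D v then (((SPcost M D K0 v - br M D (Kof v) : ℝ)) : EReal) else 0)
     else ⊤)
  else 0

/-- Cost of a play with respect to `μ`. -/
noncomputable def costMu (π : List (Vtx X Q)) : EReal :=
  (List.zipWith (mu M D K0) π π.tail).sum

open Classical in
/-- `Val^μ(σa)`. -/
noncomputable def Valmu (σa : List (Vtx X Q) → Option (Vtx X Q)) : EReal :=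
  if AValid M D K0 σa ∧
     (∀ σe ∈ SE M D, ∃ π, IsOutcome M D K0 σa σe π ∧ InVF D π.getLast!)
  then sSup { c : EReal | ∃ σe ∈ SE M D, costMu M D K0 (outcome M D K0 σa σe) = c }
  else ⊤

/-- The environment strategy `σ_e^T` induced by a compatible environment `T`. -/
def envOf (T : CompatEnv M) : Vtx X Q → Vtx X Q
  | .env x q K xh => .ag xh (D.f q (M.L x)) (kupdate K (xh, T.1 xh))
  | v => v

/-- Best responses are achievable: for every compatible `T`, the best cost against
`σ_e^T` in the arena equals the minimum cost of a path of `T` accomplishing the task. -/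
def BRAchievable : Prop :=
  ∀ T : CompatEnv M,
    bestCost M D K0 (envOf M D T) =
      sInf { c | ∃ ρ, IsEnvPath M T.1 ρ ∧ Accomplishes M D ρ ∧ costP M ρ = c }

/-- The sequence of `X`-components of the agent vertices of a play. -/
def agentStates (π : List (Vtx X Q)) : List X :=
  π.filterMap (fun v => match v with | .ag x _ _ => some x | _ => none)

/-- The history induced by a complete play. -/
def inducedHist (π : List (Vtx X Q)) : List (X × Finset X) :=
  π.filterMap (fun v => match v with | .ag x _ K => some (x, lookupO K x) | _ => none)

/-- A branching environment vertex: at least two outgoing edges. -/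
def Branching (v : Vtx X Q) : Prop :=
  IsEnvV v ∧ ∃ u1 u2, u1 ≠ u2 ∧ Edge M D v u1 ∧ Edge M D v u2

open Classical in
/-- The sublist of branching environment vertices of a play, in order. -/
noncomputable def branchList (π : List (Vtx X Q)) : List (Vtx X Q) :=
  π.filter (fun v => decide (Branching M D v))


/-! ### Proof of the correspondence -/

section Proof

set_option linter.unusedSectionVars false

lemma sum_zip_snoc {α : Type} (g : α → α → ℝ) (l : List α) (a b : α)
    (h : l.getLast? = some a) :
    (List.zipWith g (l ++ [b]) (l ++ [b]).tail).sum =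
      (List.zipWith g l l.tail).sum + g a b := by
  induction l with
  | nil => simp at h
  | cons c t ih =>
    cases t with
    | nil => simp at h; subst h; simp
    | cons d s =>
      have := ih (by simpa using h)
      simp only [List.cons_append, List.tail_cons, List.zipWith_cons_cons, List.sum_cons] at this ⊢
      rw [this]; ring

lemma explored_iff_any (K : List (X × Finset X)) (x : X) :
    K.any (fun k => decide (k.1 = x)) = true ↔ Explored K x := by
  simp [Explored]

lemma kupdate_of_explored {K : List (X × Finset X)} {x : X} (h : Explored K x) (o : Finset X) :
    kupdate K (x, o) = K := by
  unfold kupdate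
  rw [if_pos]
  exact (explored_iff_any K x).2 h

lemma kupdate_of_not {K : List (X × Finset X)} {x : X} (h : ¬ Explored K x) (o : Finset X) :
    kupdate K (x, o) = K ++ [(x, o)] := by
  unfold kupdate
  rw [if_neg]
  intro h'
  exact h ((explored_iff_any K x).1 h')

lemma explored_kupdate (K : List (X × Finset X)) (x : X) (o : Finset X) :
    Explored (kupdate K (x, o)) x := by
  by_cases h : Explored K x
  · rwa [kupdate_of_explored h]
  · rw [kupdate_of_not h]; exact ⟨o, by simp⟩

lemma lookup_kupdate_not {K : List (X × Finset X)} {x : X} (h : ¬ Explored K x) (o : Finset X) :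
    lookupO (kupdate K (x, o)) x = o := by
  rw [kupdate_of_not h]
  unfold lookupO
  have : K.find? (fun k => decide (k.1 = x)) = none := by
    rw [List.find?_eq_none]
    rintro ⟨a, b⟩ hm hx
    simp at hx
    subst hx
    exact h ⟨b, hm⟩
  rw [List.find?_append, this]
  simp

lemma inTK_kupdate {K : List (X × Finset X)} (T : CompatEnv M) (h : InTK M K T) (x : X) :
    InTK M (kupdate K (x, T.1 x)) T := by
  by_cases hx : Explored K x
  · rwa [kupdate_of_explored hx]
  · rw [kupdate_of_not hx]
    intro p hp
    rcases List.mem_append.1 hp with hp | hp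
    · exact h p hp
    · simp at hp; subst hp; rfl

lemma lookup_of_inTK {K : List (X × Finset X)} (T : CompatEnv M) (h : InTK M K T) {x : X}
    (hx : Explored K x) : lookupO K x = T.1 x := by
  unfold lookupO
  obtain ⟨o, ho⟩ := hx
  cases hf : K.find? (fun k => decide (k.1 = x)) with
  | none =>
    rw [List.find?_eq_none] at hf
    exact absurd (hf _ ho) (by simp)
  | some p =>
    have h1 := List.find?_some hf
    have h2 := List.mem_of_find?_eq_some hf
    simp at h1
    simp [← h1, h p h2]

/-- Environment paths that follow a strategy (a partial outcome). -/
inductive ReachX (ξ : List (X × Finset X) → Option X) (δ : X → Finset X) : List X → Prop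
  | base : ReachX ξ δ [M.x0]
  | step (ρ : List X) (x y : X) : ReachX ξ δ ρ → ρ.getLast? = some x →
      ξ (histOf δ ρ) = some y → y ∈ δ x → ReachX ξ δ (ρ ++ [y])

/-- Environment paths, inductively. -/
inductive EP (δ : X → Finset X) : List X → Prop
  | base : EP δ [M.x0]
  | step (ρ : List X) (x y : X) : EP δ ρ → ρ.getLast? = some x → y ∈ δ x → EP δ (ρ ++ [y])

variable {M} in
lemma ReachX.ep {ξ : List (X × Finset X) → Option X} {δ : X → Finset X} {ρ : List X}
    (h : ReachX M ξ δ ρ) : EP M δ ρ := by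
  induction h with
  | base => exact .base
  | step ρ x y _ hl _ hy ih => exact .step ρ x y ih hl hy

variable {M} in
lemma EP.envPath {δ : X → Finset X} {ρ : List X} (h : EP M δ ρ) : IsEnvPath M δ ρ := by
  induction h with
  | base => exact ⟨by simp, by simp, List.isChain_singleton _⟩
  | step ρ x y _ hl hy ih =>
    obtain ⟨h1, h2, h3⟩ := ih
    refine ⟨by simp, ?_, ?_⟩
    · rw [List.head?_append_of_ne_nil _ h1]; exact h2
    · refine List.isChain_append.2 ⟨h3, List.isChain_singleton _, ?_⟩
      intro a ha b hb
      simp only [hl, Option.mem_def, Option.some.injEq] at ha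
      simp at hb
      subst ha; subst hb; exact hy

variable {M} in
lemma EP.history {T : CompatEnv M} {ρ : List X} (h : EP M T.1 ρ) :
    IsHistory M (histOf T.1 ρ) := by
  obtain ⟨h1, h2, h3⟩ := h.envPath
  refine ⟨by simpa [histOf] using h1, ?_, ?_, ?_, ?_⟩
  · simpa [histOf] using h2
  · intro p hp
    simp only [histOf, List.mem_map] at hp
    obtain ⟨a, _, rfl⟩ := hp
    exact T.2 a
  · exact (List.isChain_map _).2 h3
  · intro p hp p' hp' he
    simp only [histOf, List.mem_map] at hp hp'
    obtain ⟨a, _, rfl⟩ := hp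
    obtain ⟨b, _, rfl⟩ := hp'
    simp at he ⊢; rw [he]

lemma take_succ_snoc {α : Type} (l : List α) (i : ℕ) (h : i < l.length) :
    l.take (i+1) = l.take i ++ [l[i]] := by
  simp

lemma getLast_take {α : Type} (l : List α) (i : ℕ) (h : i < l.length) :
    (l.take (i+1)).getLast? = some l[i] := by
  rw [take_succ_snoc l i h, List.getLast?_concat]

variable {M} in
lemma reach_of_outcomePath {ξ : List (X × Finset X) → Option X} {δ : X → Finset X} {ρ : List X}
    (h : IsOutcomePath M ξ δ ρ) : ReachX M ξ δ ρ := by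
  obtain ⟨⟨h1, h2, h3⟩, h4, h5⟩ := h
  have hpos : 0 < ρ.length := List.length_pos_iff.2 h1
  have key : ∀ i, i < ρ.length → ReachX M ξ δ (ρ.take (i+1)) := by
    intro i
    induction i with
    | zero =>
      intro _
      cases ρ with
      | nil => simp at h1
      | cons a t => simp at h2; subst h2; simpa using ReachX.base
    | succ i ih =>
      intro hi
      rw [take_succ_snoc ρ (i+1) hi]
      refine ReachX.step _ (ρ[i]'(by omega)) _ (ih (by omega)) (getLast_take ρ i (by omega))
        (h4 i hi) ?_
      exact List.isChain_iff_getElem.1 h3 i hi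
  have := key (ρ.length - 1) (by omega)
  rwa [Nat.sub_add_cancel hpos, List.take_length] at this

variable {M} in
lemma outcomePath_of_reach {ξ : List (X × Finset X) → Option X} {δ : X → Finset X} {ρ : List X}
    (h : ReachX M ξ δ ρ) (hn : ξ (histOf δ ρ) = none) : IsOutcomePath M ξ δ ρ := by
  refine ⟨h.ep.envPath, ?_, hn⟩
  clear hn
  induction h with
  | base => intro i hi; simp at hi
  | step ρ x y _ hl hs hy ih =>
    intro i hi
    simp only [List.length_append, List.length_singleton] at hi
    by_cases hc : i + 1 < ρ.length
    · rw [List.take_append_of_le_length (by omega), List.getElem_append_left hc]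
      exact ih i hc
    · have he : i + 1 = ρ.length := by omega
      rw [List.take_append_of_le_length (by omega), List.getElem_append_right (by omega),
        List.take_of_length_le (by omega), hs]
      simp

variable {M} in
lemma reach_prefix {ξ : List (X × Finset X) → Option X} {δ : X → Finset X} {ρ ρ' : List X}
    (h : ReachX M ξ δ ρ) (h' : IsOutcomePath M ξ δ ρ') : ρ <+: ρ' := by
  induction h with
  | base =>
    obtain ⟨⟨h1, h2, _⟩, _⟩ := h'
    cases ρ' with
    | nil => simp at h1
    | cons a t => simp at h2; subst h2; simp
  | step ρ x y _ hl hs hy ih =>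
    obtain ⟨t, rfl⟩ := ih
    cases t with
    | nil => have := h'.2.2; simp [hs] at this
    | cons z t =>
      have hpos : 0 < ρ.length := by
        cases ρ with
        | nil => simp at hl
        | cons _ _ => simp
      have := h'.2.1 (ρ.length - 1) (by simp; omega)
      simp only [Nat.sub_add_cancel hpos] at this
      rw [List.getElem_append_right (by omega)] at this
      simp [hs] at this
      subst this
      exact ⟨t, by simp⟩

variable {M} in
lemma outcomePath_unique {ξ : List (X × Finset X) → Option X} {δ : X → Finset X} {ρ ρ' : List X}
    (h : IsOutcomePath M ξ δ ρ) (h' : IsOutcomePath M ξ δ ρ') : ρ = ρ' :=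
  List.IsPrefix.eq_of_length_le (reach_prefix (reach_of_outcomePath h) h')
    (reach_prefix (reach_of_outcomePath h') h).length_le

variable {M} in
lemma outcomePath_eq {ξ : List (X × Finset X) → Option X} {T : CompatEnv M} {ρ : List X}
    (h : IsOutcomePath M ξ T.1 ρ) : outcomePath M ξ T = ρ := by
  unfold outcomePath
  have hex : ∃ ρ, IsOutcomePath M ξ T.1 ρ := ⟨ρ, h⟩
  rw [dif_pos hex]
  exact outcomePath_unique hex.choose_spec h

/-- State of the play simulation: play, current state, automaton state, knowledge. -/
structure PS (X Q : Type) where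
  pl : List (Vtx X Q)
  x : X
  q : Q
  K : List (X × Finset X)

/-- One round of the play simulation. -/
def pstep (s : PS X Q) (p : X × Finset X) : PS X Q where
  pl := s.pl ++ [.env s.x s.q s.K p.1, .ag p.1 (D.f s.q (M.L s.x)) (kupdate s.K p)]
  x := p.1
  q := D.f s.q (M.L s.x)
  K := kupdate s.K p

/-- The simulated play of a history. -/
def sim (h : List (X × Finset X)) : PS X Q :=
  h.tail.foldl (pstep M D) ⟨[v0 M D K0], M.x0, D.q0, K0⟩

/-- The simulated play along a path in a fixed environment. -/
def simT (T : CompatEnv M) (ρ : List X) : PS X Q := sim M D K0 (histOf T.1 ρ)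

lemma simT_base (T : CompatEnv M) :
    simT M D K0 T [M.x0] = ⟨[v0 M D K0], M.x0, D.q0, K0⟩ := rfl

lemma simT_snoc (T : CompatEnv M) (ρ : List X) (y : X) (h : ρ ≠ []) :
    simT M D K0 T (ρ ++ [y]) = pstep M D (simT M D K0 T ρ) (y, T.1 y) := by
  unfold simT sim histOf
  rw [List.map_append, List.tail_append_of_ne_nil (by simpa using h), List.foldl_append]
  rfl

/-- Invariants of the simulation. -/
structure Inv (T : CompatEnv M) (ρ : List X) (s : PS X Q) : Prop where
  last : s.pl.getLast? = some (.ag s.x s.q s.K)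
  rlast : ρ.getLast? = some s.x
  q_eq : s.q = frun M D D.q0 ρ.dropLast
  expl : Explored s.K s.x
  intk : InTK M s.K T
  ags : agentStates s.pl = ρ
  hist : inducedHist s.pl = histOf T.1 ρ
  cost : costG M s.pl = costP M ρ
  play : IsPlay M D K0 s.pl

variable {M D K0} in
lemma Inv.look {T : CompatEnv M} {ρ : List X} {s : PS X Q} (h : Inv M D K0 T ρ s) :
    lookupO s.K s.x = T.1 s.x := lookup_of_inTK M T h.intk h.expl

variable {M D K0} in
lemma Inv.edge {T : CompatEnv M} {ρ : List X} {s : PS X Q} (h : Inv M D K0 T ρ s) {y : X}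
    (hy : y ∈ T.1 s.x) : Edge M D (.ag s.x s.q s.K) (.env s.x s.q s.K y) :=
  ⟨rfl, rfl, rfl, h.expl, by rw [h.look]; exact hy⟩

lemma simT_inv (hinit : IsInitK M K0) (T : CompatEnv M) {ρ : List X} (h : EP M T.1 ρ) :
    Inv M D K0 T ρ (simT M D K0 T ρ) := by
  induction h with
  | base =>
    rw [simT_base]
    have he : Explored K0 M.x0 := hinit.2.2 _ M.x0_known
    have hk : InTK M K0 T := by
      intro p hp
      have := T.2 p.1
      rw [hinit.2.1 p hp] at this
      simpa using this
    exact {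
      last := rfl
      rlast := rfl
      q_eq := rfl
      expl := he
      intk := hk
      ags := rfl
      hist := by simp [inducedHist, v0, histOf, lookup_of_inTK M T hk he]
      cost := by simp [costG, costP]
      play := ⟨rfl, List.isChain_singleton _⟩ }
  | step ρ x y hρ hl hy ih =>
    have hne : ρ ≠ [] := hρ.envPath.1
    rw [simT_snoc M D K0 T ρ y hne]
    generalize simT M D K0 T ρ = s at ih
    have hx : x = s.x := by have := ih.rlast; rw [hl] at this; simpa using this
    subst hx
    have hk := inTK_kupdate M T ih.intk y
    have he := explored_kupdate s.K y (T.1 y)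
    have hsplit : ∀ a b : Vtx X Q, s.pl ++ [a, b] = (s.pl ++ [a]) ++ [b] := by simp
    exact {
      last := by simp [pstep]
      rlast := by simp [pstep]
      q_eq := by
        simp only [pstep, List.dropLast_concat]
        rw [ih.q_eq]
        obtain ⟨t, ht⟩ : ∃ t, ρ = t ++ [s.x] := List.getLast?_eq_some_iff.1 hl
        rw [ht]
        simp [frun]
      expl := he
      intk := hk
      ags := by
        have := ih.ags
        simp only [agentStates, pstep, List.filterMap_append] at this ⊢
        rw [this]; simp
      hist := by
        have := ih.hist
        simp only [inducedHist, pstep, List.filterMap_append, histOf, List.map_append] at this ⊢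
        rw [this]; simp [lookup_of_inTK M T hk he]
      cost := by
        have := ih.cost
        unfold costG costP at this ⊢
        simp only [pstep]
        rw [hsplit, sum_zip_snoc (wG M) _ (.env s.x s.q s.K y) _ (by simp),
          sum_zip_snoc (wG M) _ _ _ ih.last, sum_zip_snoc M.w _ _ _ hl, this]
        simp [wG]
      play := by
        obtain ⟨p1, p2⟩ := ih.play
        have hpl : s.pl ≠ [] := by
          intro h0; have := ih.last; simp [h0] at this
        refine ⟨?_, ?_⟩
        · simp only [pstep]
          rw [List.head?_append_of_ne_nil _ hpl]; exact p1
        · simp only [pstep]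
          refine List.isChain_append.2 ⟨p2, ?_, ?_⟩
          · refine List.isChain_pair.2 ?_
            exact ⟨rfl, rfl, T.1 y, T.2 y, rfl⟩
          · intro a ha b hb
            simp only [ih.last, Option.mem_def, Option.some.injEq] at ha
            simp at hb
            subst ha; subst hb
            exact ih.edge hy }

/-- The PK-WTS strategy and the arena strategy make the same decisions. -/
def Matched (ξ : List (X × Finset X) → Option X)
    (σa : List (Vtx X Q) → Option (Vtx X Q)) : Prop :=
  ∀ (T : CompatEnv M) (ρ : List X), EP M T.1 ρ →
    σa (simT M D K0 T ρ).pl = (ξ (histOf T.1 ρ)).map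
      (fun y => .env (simT M D K0 T ρ).x (simT M D K0 T ρ).q (simT M D K0 T ρ).K y)

lemma getLast!_of {α : Type} [Inhabited α] {l : List α} {a : α} (h : l.getLast? = some a) :
    l.getLast! = a := by
  rw [List.getLast!_eq_getLast?_getD, h]; rfl

/-- Local consistency of a play with the strategies. -/
def Conds (σa : List (Vtx X Q) → Option (Vtx X Q)) (σe : Vtx X Q → Vtx X Q)
    (π : List (Vtx X Q)) : Prop :=
  ∀ i (h : i + 1 < π.length),
    (IsAgV (π[i]'(Nat.lt_of_succ_lt h)) → σa (π.take (i+1)) = some (π[i+1]'h)) ∧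
    (IsEnvV (π[i]'(Nat.lt_of_succ_lt h)) → σe (π[i]'(Nat.lt_of_succ_lt h)) = π[i+1]'h)

lemma conds_snoc {σa : List (Vtx X Q) → Option (Vtx X Q)} {σe : Vtx X Q → Vtx X Q}
    {π : List (Vtx X Q)} {a b : Vtx X Q} (h : Conds σa σe π) (hl : π.getLast? = some a)
    (h1 : IsAgV a → σa π = some b) (h2 : IsEnvV a → σe a = b) : Conds σa σe (π ++ [b]) := by
  obtain ⟨t, rfl⟩ := List.getLast?_eq_some_iff.1 hl
  intro i hi
  by_cases hc : i + 1 < (t ++ [a]).length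
  · rw [List.take_append_of_le_length (by omega), List.getElem_append_left hc,
      List.getElem_append_left (by omega)]
    exact h i hc
  · have he : i + 1 = (t ++ [a]).length := by
      simp only [List.length_append, List.length_singleton] at hi hc ⊢; omega
    have hit : i = t.length := by simpa using he
    subst hit
    have e1 : ((t ++ [a]) ++ [b])[t.length]'(by simp) = a := by simp
    have e2 : ((t ++ [a]) ++ [b])[t.length + 1]'(by simp) = b := by simp
    have e3 : ((t ++ [a]) ++ [b]).take (t.length + 1) = t ++ [a] := by
      rw [List.take_append_of_le_length (by simp), List.take_of_length_le (by simp)]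
    rw [e1, e2, e3]
    exact ⟨h1, h2⟩

lemma outcome_of_path (hinit : IsInitK M K0) {ξ : List (X × Finset X) → Option X}
    {σa : List (Vtx X Q) → Option (Vtx X Q)} (hm : Matched M D K0 ξ σa) (T : CompatEnv M)
    {ρ : List X} (h : IsOutcomePath M ξ T.1 ρ) :
    IsOutcome M D K0 σa (envOf M D T) (simT M D K0 T ρ).pl := by
  have hr := reach_of_outcomePath h
  have hI := simT_inv M D K0 hinit T hr.ep
  have hC : Conds σa (envOf M D T) (simT M D K0 T ρ).pl := by
    clear hI h
    induction hr with
    | base => rw [simT_base]; intro i hi; simp at hi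
    | step ρ x y hρ hl hs hy ih =>
      have hI := simT_inv M D K0 hinit T hρ.ep
      have hmm := hm T ρ hρ.ep
      rw [simT_snoc M D K0 T ρ y hρ.ep.envPath.1]
      generalize simT M D K0 T ρ = s at *
      have : (pstep M D s (y, T.1 y)).pl = (s.pl ++ [.env s.x s.q s.K y]) ++
          [.ag y (D.f s.q (M.L s.x)) (kupdate s.K (y, T.1 y))] := by simp [pstep]
      rw [this]
      refine conds_snoc (conds_snoc ih hI.last ?_ ?_) (a := .env s.x s.q s.K y) (by simp) ?_ ?_
      · intro _; rw [hmm, hs]; rfl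
      · intro h; exact h.elim
      · intro h; exact h.elim
      · intro _; rfl
  refine ⟨hI.play, hC, ?_, ?_⟩
  · rw [getLast!_of hI.last]; trivial
  · rw [hm T ρ hr.ep, h.2.2]; rfl

lemma path_of_outcome (hinit : IsInitK M K0) {ξ : List (X × Finset X) → Option X}
    {σa : List (Vtx X Q) → Option (Vtx X Q)} (hm : Matched M D K0 ξ σa) (T : CompatEnv M)
    {π : List (Vtx X Q)} (h : IsOutcome M D K0 σa (envOf M D T) π) :
    ∃ ρ, IsOutcomePath M ξ T.1 ρ ∧ π = (simT M D K0 T ρ).pl := by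
  obtain ⟨⟨h1, h2⟩, h3, h4, h5⟩ := h
  have hedge := List.isChain_iff_getElem.1 h2
  have hpos : 0 < π.length := by
    cases π with
    | nil => simp at h1
    | cons _ _ => simp
  have hlastget : π.getLast? = some (π[π.length - 1]'(by omega)) := by
    rw [List.getLast?_eq_getElem?]; simp
  rw [getLast!_of hlastget] at h4
  have key : ∀ n, 2 * n < π.length →
      ∃ ρ, ReachX M ξ T.1 ρ ∧ π.take (2 * n + 1) = (simT M D K0 T ρ).pl := by
    intro n
    induction n with
    | zero =>
      intro _
      refine ⟨[M.x0], .base, ?_⟩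
      rw [simT_base]
      cases π with
      | nil => simp at hpos
      | cons a t => simp at h1; simp [h1]
    | succ n ih =>
      intro hn
      obtain ⟨ρ, hρ, hp⟩ := ih (by omega)
      have hI := simT_inv M D K0 hinit T hρ.ep
      have hmm := hm T ρ hρ.ep
      have hsn := fun y => simT_snoc M D K0 T ρ y hρ.ep.envPath.1
      generalize simT M D K0 T ρ = s at *
      have hl := getLast_take π (2 * n) (by omega)
      rw [hp, hI.last, Option.some.injEq] at hl
      have c1 := (h3 (2 * n) (by omega)).1 (by rw [← hl]; trivial)
      have e1 := hedge (2 * n) (by omega)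
      rw [hp, hmm] at c1
      obtain ⟨y, hy, hv⟩ := Option.map_eq_some_iff.1 c1
      have c2 := (h3 (2 * n + 1) (by omega)).2 (by rw [← hv]; trivial)
      rw [← hl, ← hv] at e1
      have hyT : y ∈ T.1 s.x := by rw [← hI.look]; exact e1.2.2.2.2
      refine ⟨ρ ++ [y], .step ρ s.x y hρ hI.rlast hy hyT, ?_⟩
      rw [hsn y, show 2 * (n + 1) + 1 = (2 * n + 1 + 1) + 1 by ring,
        take_succ_snoc π (2 * n + 1 + 1) (by omega), take_succ_snoc π (2 * n + 1) (by omega), hp,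
        ← c2, ← hv]
      simp [pstep, envOf]
  obtain ⟨n, hn | hn⟩ : ∃ n, π.length = 2 * n + 1 ∨ π.length = 2 * n + 2 :=
    ⟨(π.length - 1) / 2, by omega⟩
  · obtain ⟨ρ, hρ, hp⟩ := key n (by omega)
    rw [← hn, List.take_length] at hp
    refine ⟨ρ, outcomePath_of_reach hρ ?_, hp⟩
    have := hm T ρ hρ.ep
    rw [← hp, h5] at this
    simpa using this.symm
  · exfalso
    obtain ⟨ρ, hρ, hp⟩ := key n (by omega)
    have hI := simT_inv M D K0 hinit T hρ.ep
    have hl := getLast_take π (2 * n) (by omega)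
    rw [hp, hI.last, Option.some.injEq] at hl
    have e1 := hedge (2 * n) (by omega)
    rw [← hl] at e1
    have : π[π.length - 1]'(by omega) = π[2 * n + 1]'(by omega) := by congr 1; omega
    rw [this] at h4
    generalize π[2 * n + 1]'(by omega) = v at e1 h4
    cases v with
    | ag => exact e1
    | env => exact h4

lemma outcome_eq (hinit : IsInitK M K0) {ξ : List (X × Finset X) → Option X}
    {σa : List (Vtx X Q) → Option (Vtx X Q)} (hm : Matched M D K0 ξ σa) (T : CompatEnv M)
    {ρ : List X} (h : IsOutcomePath M ξ T.1 ρ) :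
    outcome M D K0 σa (envOf M D T) = (simT M D K0 T ρ).pl := by
  have hex : ∃ π, IsOutcome M D K0 σa (envOf M D T) π :=
    ⟨_, outcome_of_path M D K0 hinit hm T h⟩
  unfold outcome
  rw [dif_pos hex]
  obtain ⟨ρ', h', he⟩ := path_of_outcome M D K0 hinit hm T hex.choose_spec
  rw [he, outcomePath_unique h' h]

/-- On environment vertices, each environment strategy is induced by some `T`. -/
lemma exists_env {σe : Vtx X Q → Vtx X Q} (hσ : σe ∈ SE M D) :
    ∃ T : CompatEnv M, ∀ v, IsEnvV v → σe v = envOf M D T v := by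
  obtain ⟨h1, h2⟩ := hσ
  have aux : ∀ x q K xh, ∃ o ∈ M.Δ xh,
      σe (.env x q K xh) = .ag xh (D.f q (M.L x)) (kupdate K (xh, o)) := by
    intro x q K xh
    have he := h1 (.env x q K xh) trivial
    generalize σe (.env x q K xh) = v at he
    cases v with
    | env => exact he.elim
    | ag a b c =>
      obtain ⟨rfl, rfl, o, ho, rfl⟩ := he
      exact ⟨o, ho, rfl⟩
  have hnil : ∀ xh : X, ¬ Explored ([] : List (X × Finset X)) xh := by
    rintro xh ⟨o, ho⟩; simp at ho
  refine ⟨⟨fun xh => lookupO (Kof (σe (.env default default [] xh))) xh, ?_⟩, ?_⟩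
  · intro xh
    obtain ⟨o, ho, he⟩ := aux default default [] xh
    simp only [he, Kof]
    rw [lookup_kupdate_not (hnil xh)]; exact ho
  · intro v hv
    cases v with
    | ag => exact hv.elim
    | env x q K xh =>
      obtain ⟨o, ho, he⟩ := aux x q K xh
      rw [he]
      simp only [envOf]
      by_cases hK : Explored K xh
      · rw [kupdate_of_explored hK, kupdate_of_explored hK]
      · have h := h2 x q K default default [] xh hK (hnil xh)
        rw [he] at h
        simp only [Kof] at h
        rw [lookup_kupdate_not hK] at h
        simp only [Kof]
        rw [← h]

lemma isOutcome_congr {σe σe' : Vtx X Q → Vtx X Q} (h : ∀ v, IsEnvV v → σe v = σe' v)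
    (σa : List (Vtx X Q) → Option (Vtx X Q)) :
    IsOutcome M D K0 σa σe = IsOutcome M D K0 σa σe' := by
  funext π
  unfold IsOutcome
  refine propext (and_congr_right fun _ => and_congr_left fun _ => forall_congr' fun i => forall_congr' fun hi =>
    and_congr_right fun _ => forall_congr' fun hv => ?_)
  rw [h _ hv]

lemma outcome_congr {σe σe' : Vtx X Q → Vtx X Q} (h : ∀ v, IsEnvV v → σe v = σe' v)
    (σa : List (Vtx X Q) → Option (Vtx X Q)) :
    outcome M D K0 σa σe = outcome M D K0 σa σe' := by
  unfold outcome
  rw [isOutcome_congr M D K0 h σa]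

lemma inVF_iff {T : CompatEnv M} {ρ : List X} {s : PS X Q} (hI : Inv M D K0 T ρ s)
    (hne : ρ ≠ []) : InVF D s.pl.getLast! ↔ Accomplishes M D ρ := by
  rw [getLast!_of hI.last]
  simp [InVF, Accomplishes, hne, hI.q_eq]

/-- Matched strategies: satisfying the task implies winning. -/
lemma mem_SA (hinit : IsInitK M K0) {ξ : List (X × Finset X) → Option X}
    {σa : List (Vtx X Q) → Option (Vtx X Q)} (hm : Matched M D K0 ξ σa)
    (hv : AValid M D K0 σa) (hξ : ξ ∈ StraA M D) : σa ∈ SA M D K0 := by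
  refine ⟨hv, fun σe hσe => ?_⟩
  obtain ⟨T, hT⟩ := exists_env M D hσe
  obtain ⟨ρ, h1, h2⟩ := hξ.2 T
  refine ⟨(simT M D K0 T ρ).pl, ?_, ?_⟩
  · rw [isOutcome_congr M D K0 hT]
    exact outcome_of_path M D K0 hinit hm T h1
  · exact (inVF_iff M D K0 (simT_inv M D K0 hinit T (reach_of_outcomePath h1).ep) h2.1).2 h2

/-- Matched strategies: winning implies satisfying the task. -/
lemma mem_StraA (hinit : IsInitK M K0) (henv : ∀ T : CompatEnv M, envOf M D T ∈ SE M D)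
    {ξ : List (X × Finset X) → Option X}
    {σa : List (Vtx X Q) → Option (Vtx X Q)} (hm : Matched M D K0 ξ σa)
    (hv : XiValid M ξ) (hσ : σa ∈ SA M D K0) : ξ ∈ StraA M D := by
  refine ⟨hv, fun T => ?_⟩
  obtain ⟨π, h1, h2⟩ := hσ.2 _ (henv T)
  obtain ⟨ρ, h3, rfl⟩ := path_of_outcome M D K0 hinit hm T h1
  exact ⟨ρ, h3, (inVF_iff M D K0 (simT_inv M D K0 hinit T (reach_of_outcomePath h3).ep)
    h3.1.1).1 h2⟩

lemma matched_spec (hinit : IsInitK M K0) {ξ : List (X × Finset X) → Option X}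
    {σa : List (Vtx X Q) → Option (Vtx X Q)} (hm : Matched M D K0 ξ σa)
    (hξ : ξ ∈ StraA M D) (T : CompatEnv M) :
    agentStates (outcome M D K0 σa (envOf M D T)) = outcomePath M ξ T ∧
        costG M (outcome M D K0 σa (envOf M D T)) = costP M (outcomePath M ξ T) := by
  obtain ⟨ρ, h1, h2⟩ := hξ.2 T
  have hI := simT_inv M D K0 hinit T (reach_of_outcomePath h1).ep
  rw [outcome_eq M D K0 hinit hm T h1, outcomePath_eq h1]
  exact ⟨hI.ags, hI.cost⟩

open Classical in
/-- The arena strategy that simulates `ξ`. -/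
noncomputable def toA (ξ : List (X × Finset X) → Option X) (π : List (Vtx X Q)) :
    Option (Vtx X Q) :=
  match π.getLast?, ξ (inducedHist π) with
  | some (.ag x q K), some y =>
      if Edge M D (.ag x q K) (.env x q K y) then some (.env x q K y) else none
  | _, _ => none

lemma toA_valid (ξ : List (X × Finset X) → Option X) : AValid M D K0 (toA M D ξ) := by
  intro π u v _ hl hu hs
  cases u with
  | env => exact hu.elim
  | ag x q K =>
    unfold toA at hs
    rw [hl] at hs
    cases hy : ξ (inducedHist π) with
    | none => simp [hy] at hs
    | some y =>
      simp only [hy] at hs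
      split_ifs at hs with he
      simp at hs
      subst hs
      exact he

lemma toA_matched (hinit : IsInitK M K0) {ξ : List (X × Finset X) → Option X}
    (hξ : XiValid M ξ) : Matched M D K0 ξ (toA M D ξ) := by
  intro T ρ hρ
  have hI := simT_inv M D K0 hinit T hρ
  generalize simT M D K0 T ρ = s at *
  unfold toA
  rw [hI.last, hI.hist]
  cases hy : ξ (histOf T.1 ρ) with
  | none => simp
  | some y =>
    have hmem : y ∈ T.1 s.x := by
      refine hξ _ (s.x, T.1 s.x) y hρ.history ?_ hy
      simp [histOf, hI.rlast]
    simp only [Option.map_some]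
    rw [if_pos (hI.edge hmem)]

open Classical in
/-- The PK-WTS strategy that simulates `σa`. -/
noncomputable def toXi (σa : List (Vtx X Q) → Option (Vtx X Q)) (h : List (X × Finset X)) :
    Option X :=
  match σa (sim M D K0 h).pl, h.getLast? with
  | some (.env _ _ _ y), some p => if y ∈ p.2 then some y else none
  | _, _ => none

lemma toXi_valid (σa : List (Vtx X Q) → Option (Vtx X Q)) : XiValid M (toXi M D K0 σa) := by
  intro h p x _ hl hs
  unfold toXi at hs
  rw [hl] at hs
  rcases hy : σa (sim M D K0 h).pl with _ | v
  · simp [hy] at hs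
  · cases v with
    | ag => simp [hy] at hs
    | env a b c y =>
      simp only [hy] at hs
      split_ifs at hs with he
      simp at hs
      subst hs
      exact he

lemma toXi_matched (hinit : IsInitK M K0) {σa : List (Vtx X Q) → Option (Vtx X Q)}
    (hσ : AValid M D K0 σa) : Matched M D K0 (toXi M D K0 σa) σa := by
  intro T ρ hρ
  have hI := simT_inv M D K0 hinit T hρ
  unfold toXi
  change _ = Option.map _ (match σa (simT M D K0 T ρ).pl, (histOf T.1 ρ).getLast? with
  | some (.env _ _ _ y), some p => if y ∈ p.2 then some y else none
  | _, _ => none)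
  generalize simT M D K0 T ρ = s at *
  have hl : (histOf T.1 ρ).getLast? = some (s.x, T.1 s.x) := by simp [histOf, hI.rlast]
  rw [hl]
  cases hs : σa s.pl with
  | none => simp
  | some v =>
    have he := hσ _ _ _ hI.play hI.last trivial hs
    cases v with
    | ag => exact he.elim
    | env a b c y =>
      obtain ⟨rfl, rfl, rfl, _, hy⟩ := he
      rw [hI.look] at hy
      simp [hy]

lemma bestCost_eq (hinit : IsInitK M K0) (henv : ∀ T : CompatEnv M, envOf M D T ∈ SE M D)
    (T : CompatEnv M) : bestCost M D K0 (envOf M D T) =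
      sInf { c | ∃ ξ' ∈ StraA M D, costP M (outcomePath M ξ' T) = c } := by
  unfold bestCost
  congr 1
  ext c
  constructor
  · rintro ⟨σa, hσ, rfl⟩
    have hm := toXi_matched M D K0 hinit hσ.1
    have hξ := mem_StraA M D K0 hinit henv hm (toXi_valid M D K0 σa) hσ
    exact ⟨_, hξ, (matched_spec M D K0 hinit hm hξ T).2.symm⟩
  · rintro ⟨ξ, hξ, rfl⟩
    have hm := toA_matched M D K0 hinit hξ.1
    exact ⟨_, mem_SA M D K0 hinit hm (toA_valid M D K0 ξ) hξ,
      (matched_spec M D K0 hinit hm hξ T).2⟩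

end Proof

/-- every task-satisfying strategy of the PK-WTS corresponds to a
winning agent strategy of the arena with the same outcomes and the same regret. -/
theorem strategy_correspondence
    (hinit : IsInitK M K0)
    (hStra : (StraA M D).Nonempty)
    (henv : ∀ T : CompatEnv M, envOf M D T ∈ SE M D)
    (ξ : List (X × Finset X) → Option X) (hξ : ξ ∈ StraA M D) :
    ∃ σa ∈ SA M D K0,
      (∀ T : CompatEnv M,
        agentStates (outcome M D K0 σa (envOf M D T)) = outcomePath M ξ T ∧
        costG M (outcome M D K0 σa (envOf M D T)) = costP M (outcomePath M ξ T)) ∧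
      regT M D ξ = regG M D K0 σa := by
  have hm := toA_matched M D K0 hinit hξ.1
  have hspec := matched_spec M D K0 hinit hm hξ
  refine ⟨toA M D ξ, mem_SA M D K0 hinit hm (toA_valid M D K0 ξ) hξ, hspec, ?_⟩
  unfold regT regG
  congr 1
  ext r
  constructor
  · rintro ⟨T, rfl⟩
    refine ⟨_, henv T, ?_⟩
    unfold regAgainst
    rw [(hspec T).2, bestCost_eq M D K0 hinit henv T]
  · rintro ⟨σe, hσe, rfl⟩
    obtain ⟨T, hT⟩ := exists_env M D hσe
    refine ⟨T, ?_⟩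
    rw [← (hspec T).2, ← bestCost_eq M D K0 hinit henv T]
    unfold regAgainst bestCost
    simp only [outcome_congr M D K0 hT]

end RegretLTL
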